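/- There is a constant α > 0 such that, when σ is chosen uniformly at random among the permutations of {1,…,n}, the probability that tw(G_σ) < α·n tends to 0 as n → ∞. -/

import Mathlib

/-- `(T, bag)` is a tree decomposition of the graph `G`. -/
def IsTreeDecomp {V ι : Type} (G : SimpleGraph V) (T : SimpleGraph ι)
    (bag : ι → Finset V) : Prop :=
  T.IsTree ∧ (∀ v : V, ∃ i, v ∈ bag i) ∧
    (∀ u v : V, G.Adj u v → ∃ i, u ∈ bag i ∧ v ∈ bag i) ∧
    (∀ v : V, (T.induce {i | v ∈ bag i}).Connected)

/-- The treewidth of a finite simple graph: the least `w` such that `G` has a tree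
decomposition all of whose bags have at most `w + 1` vertices. -/
noncomputable def treewidth {V : Type} [Fintype V] [DecidableEq V] (G : SimpleGraph V) : ℕ :=
  sInf {w | ∃ (ι : Type) (T : SimpleGraph ι) (bag : ι → Finset V),
    IsTreeDecomp G T bag ∧ ∀ i, (bag i).card ≤ w + 1}

/-- The graph `G_σ` on vertices `{1,…,n} ∪ {1',…,n'}` (`Sum.inl i` is the vertex `i+1`,
`Sum.inr i` the vertex `(i+1)'`), with the path `1 - 2 - ⋯ - n`, the path
`σ(1)' - σ(2)' - ⋯ - σ(n)'` and the perfect matching `(i, i')`. -/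
def Gsig (n : ℕ) (σ : Equiv.Perm (Fin n)) : SimpleGraph (Fin n ⊕ Fin n) :=
  SimpleGraph.fromRel (fun a b =>
    match a, b with
    | Sum.inl i, Sum.inl j => (j : ℕ) = (i : ℕ) + 1
    | Sum.inr i, Sum.inr j => ((σ.symm j : Fin n) : ℕ) = ((σ.symm i : Fin n) : ℕ) + 1
    | Sum.inl i, Sum.inr j => i = j
    | _, _ => False)

/-- The graph `G*_σ` on `{1,…,n}` obtained from `G_σ` by contracting every matching edge
`(i, i')` and merging parallel edges. -/
def GsigStar (n : ℕ) (σ : Equiv.Perm (Fin n)) : SimpleGraph (Fin n) :=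
  SimpleGraph.fromRel (fun i j =>
    (j : ℕ) = (i : ℕ) + 1 ∨ ((σ.symm j : Fin n) : ℕ) = ((σ.symm i : Fin n) : ℕ) + 1)

/-- In a tree there is a neighbour of `t` one step closer to `s ≠ t`. -/
lemma tree_next_exists {ι : Type} {T : SimpleGraph ι} (hT : T.IsTree) (t s : ι) (h : s ≠ t) :
    ∃ c, T.Adj t c ∧ T.dist c s + 1 = T.dist t s := by
  obtain ⟨p, hp⟩ := hT.connected.exists_walk_length_eq_dist t s
  cases p with
  | nil => exact absurd rfl h
  | @cons _ c _ hadj q =>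
    refine ⟨c, hadj, ?_⟩
    rw [SimpleGraph.Walk.length_cons] at hp
    have h1 := SimpleGraph.dist_le q
    have h2 := hT.connected.dist_triangle (u := t) (v := c) (w := s)
    have h3 := SimpleGraph.dist_eq_one_iff_adj.mpr hadj
    omega

/-- That neighbour is unique. -/
lemma tree_next_unique {ι : Type} {T : SimpleGraph ι} (hT : T.IsTree) (t s c d : ι)
    (hc : T.Adj t c) (hc' : T.dist c s + 1 = T.dist t s)
    (hd : T.Adj t d) (hd' : T.dist d s + 1 = T.dist t s) : c = d := by
  obtain ⟨p, hp⟩ := hT.connected.exists_walk_length_eq_dist c s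
  obtain ⟨q, hq⟩ := hT.connected.exists_walk_length_eq_dist d s
  have h1 : (SimpleGraph.Walk.cons hc p).IsPath :=
    SimpleGraph.Walk.isPath_of_length_eq_dist _ (by simp [hp, hc'])
  have h2 : (SimpleGraph.Walk.cons hd q).IsPath :=
    SimpleGraph.Walk.isPath_of_length_eq_dist _ (by simp [hq, hd'])
  have := (hT.isAcyclic.subsingleton_path t s).elim ⟨_, h1⟩ ⟨_, h2⟩
  have h3 := congrArg (fun w : T.Path t s => (w : T.Walk t s).snd) this
  simpa using h3

lemma tree_next_adj {ι : Type} {T : SimpleGraph ι} (hT : T.IsTree) (t i j c d : ι)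
    (hij : T.Adj i j)
    (hc : T.Adj t c) (hc' : T.dist c i + 1 = T.dist t i)
    (hd : T.Adj t d) (hd' : T.dist d j + 1 = T.dist t j) : c = d := by
  have h1 := SimpleGraph.dist_eq_one_iff_adj.mpr hij
  have h2 := SimpleGraph.dist_eq_one_iff_adj.mpr hij.symm
  have hct := SimpleGraph.dist_eq_one_iff_adj.mpr hc
  have hdt := SimpleGraph.dist_eq_one_iff_adj.mpr hd
  rcases hT.dist_eq_dist_add_one_of_adj t hij with h | h
  · apply tree_next_unique hT t i c d hc hc' hd
    have := hT.connected.dist_triangle (u := d) (v := j) (w := i)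
    have := hT.connected.dist_triangle (u := t) (v := d) (w := i)
    omega
  · apply tree_next_unique hT t j c d hc _ hd hd'
    have := hT.connected.dist_triangle (u := c) (v := i) (w := j)
    have := hT.connected.dist_triangle (u := t) (v := c) (w := j)
    omega

/-- Centroid of a tree decomposition. -/
lemma exists_centroid {V ι : Type} [Fintype V] [DecidableEq V] (G : SimpleGraph V)
    (T : SimpleGraph ι) (bag : ι → Finset V) (h : IsTreeDecomp G T bag) :
    ∃ (t : ι) (f : V → ι),
      (∀ u v, u ∉ bag t → v ∉ bag t → G.Adj u v → f u = f v) ∧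
      ∀ F : Finset V, (∀ u ∈ F, u ∉ bag t) → (∀ u ∈ F, ∀ v ∈ F, f u = f v) →
        2 * F.card ≤ Fintype.card V := by
  classical
  obtain ⟨hT, hcov, hedge, hconn⟩ := h
  choose s hs using hcov
  have hne : Nonempty ι := hT.connected.nonempty
  let Φ : ι → ℕ := fun t => ∑ v, T.dist t (s v)
  let t := Function.argmin Φ
  have ht : ∀ c, Φ t ≤ Φ c := fun c => Function.argmin_le Φ c
  have hnext : ∀ i, ∃ c, i ≠ t → T.Adj t c ∧ T.dist c i + 1 = T.dist t i := by
    intro i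
    by_cases hi : i = t
    · exact ⟨t, fun h => absurd hi h⟩
    · obtain ⟨c, hc⟩ := tree_next_exists hT t i hi
      exact ⟨c, fun _ => hc⟩
  choose nx hnx using hnext
  have hstep : ∀ i j, i ≠ t → j ≠ t → T.Adj i j → nx i = nx j := fun i j hi hj hij =>
    tree_next_adj hT t i j _ _ hij (hnx i hi).1 (hnx i hi).2 (hnx j hj).1 (hnx j hj).2
  have hvert : ∀ v, v ∉ bag t → ∀ i j, v ∈ bag i → v ∈ bag j → nx i = nx j := by
    intro v hv i j hi hj
    obtain ⟨p⟩ := (hconn v).preconnected ⟨i, hi⟩ ⟨j, hj⟩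
    have key : ∀ (a b : {i | v ∈ bag i}) (p : (T.induce {i | v ∈ bag i}).Walk a b),
        nx a = nx b := by
      intro a b p
      induction p with
      | nil => rfl
      | @cons a b c hab q ih =>
        rw [← ih]
        apply hstep
        · rintro h; exact hv (h ▸ a.2)
        · rintro h; exact hv (h ▸ b.2)
        · exact hab
    exact key _ _ p
  refine ⟨t, fun v => nx (s v), ?_, ?_⟩
  · intro u v hu hv huv
    obtain ⟨i, hui, hvi⟩ := hedge u v huv
    exact (hvert u hu _ i (hs u) hui).trans (hvert v hv i _ hvi (hs v))
  · intro F hF hFf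
    rcases F.eq_empty_or_nonempty with rfl | ⟨u, hu⟩
    · simp
    have hst : ∀ v ∈ F, s v ≠ t := fun v hv h => hF v hv (h ▸ hs v)
    have h1 := ht (nx (s u))
    have hadj := SimpleGraph.dist_eq_one_iff_adj.mpr (hnx _ (hst u hu)).1.symm
    have h2 : ∀ v, T.dist (nx (s u)) (s v) + (if v ∈ F then 2 else 0) ≤ T.dist t (s v) + 1 := by
      intro v
      split_ifs with hv
      · have := (hnx _ (hst v hv)).2
        have he : nx (s u) = nx (s v) := hFf u hu v hv
        rw [← he] at this
        omega
      · have := hT.connected.dist_triangle (u := nx (s u)) (v := t) (w := s v)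
        omega
    have h3 := Finset.sum_le_sum (s := Finset.univ) (fun v _ => h2 v)
    simp only [Finset.sum_add_distrib, Finset.sum_ite_mem, Finset.univ_inter, Finset.sum_const,
      smul_eq_mul, Finset.card_univ, mul_one] at h3
    simp only [Φ] at h1
    omega

/-- Balanced separators from tree decompositions. -/
lemma exists_separator {V ι : Type} [Fintype V] [DecidableEq V] (G : SimpleGraph V)
    (T : SimpleGraph ι) (bag : ι → Finset V) (h : IsTreeDecomp G T bag) (k : ℕ)
    (hk : ∀ i, (bag i).card ≤ k) (hkN : 2 * k < Fintype.card V) :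
    ∃ A X : Finset V, X.card ≤ k ∧ (∀ u ∈ A, u ∉ X) ∧
      (∀ u v, u ∈ A → G.Adj u v → v ∈ A ∨ v ∈ X) ∧
      2 * A.card ≤ Fintype.card V ∧ Fintype.card V ≤ 5 * A.card := by
  classical
  obtain ⟨t, f, hf, hF⟩ := exists_centroid G T bag h
  let cls : V → Finset V := fun v => Finset.univ.filter (fun u => u ∉ bag t ∧ f u = f v)
  have hcls : ∀ v, 2 * (cls v).card ≤ Fintype.card V := by
    intro v
    apply hF
    · intro u hu; simp only [cls, Finset.mem_filter] at hu; exact hu.2.1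
    · intro u hu w hw
      simp only [cls, Finset.mem_filter] at hu hw
      rw [hu.2.2, hw.2.2]
  by_cases hbig : ∃ v, Fintype.card V ≤ 5 * (cls v).card
  · obtain ⟨v, hv⟩ := hbig
    refine ⟨cls v, bag t, hk t, ?_, ?_, hcls v, hv⟩
    · intro u hu; simp only [cls, Finset.mem_filter] at hu; exact hu.2.1
    · intro u w hu huw
      by_cases hw : w ∈ bag t
      · exact Or.inr hw
      · left
        simp only [cls, Finset.mem_filter, Finset.mem_univ, true_and] at hu ⊢
        exact ⟨hw, by rw [← hf u w hu.1 hw huw, hu.2]⟩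
  · push Not at hbig
    let S : Finset (Finset V) := Finset.univ.filter (fun A =>
      (∀ u ∈ A, u ∉ bag t) ∧ (∀ u ∈ A, ∀ v, v ∉ bag t → f u = f v → v ∈ A) ∧
        2 * A.card ≤ Fintype.card V)
    have hS : S.Nonempty := ⟨∅, by simp [S]⟩
    obtain ⟨A, hA, hmax⟩ := S.exists_max_image Finset.card hS
    simp only [S, Finset.mem_filter, Finset.mem_univ, true_and] at hA hmax
    obtain ⟨hA1, hA2, hA3⟩ := hA
    refine ⟨A, bag t, hk t, hA1, ?_, hA3, ?_⟩
    · intro u w hu huw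
      by_cases hw : w ∈ bag t
      · exact Or.inr hw
      · exact Or.inl (hA2 u hu w hw (hf u w (hA1 u hu) hw huw))
    · by_cases hex : ∃ v, v ∉ bag t ∧ v ∉ A
      · obtain ⟨v, hv, hvA⟩ := hex
        have hlt : A.card < (A ∪ cls v).card := by
          apply Finset.card_lt_card
          refine ⟨Finset.subset_union_left, fun h => hvA (h ?_)⟩
          apply Finset.mem_union_right
          simp [cls, hv]
        have hle := Finset.card_union_le A (cls v)
        have hsm := hbig v
        by_contra hcon
        have := hmax (A ∪ cls v) ⟨?_, ?_, by omega⟩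
        · omega
        · intro u hu
          rcases Finset.mem_union.mp hu with hu | hu
          · exact hA1 u hu
          · simp only [cls, Finset.mem_filter] at hu; exact hu.2.1
        · intro u hu w hw huw
          rcases Finset.mem_union.mp hu with hu | hu
          · exact Finset.mem_union_left _ (hA2 u hu w hw huw)
          · apply Finset.mem_union_right
            simp only [cls, Finset.mem_filter, Finset.mem_univ, true_and] at hu ⊢
            exact ⟨hw, by rw [← huw, hu.2]⟩
      · push Not at hex
        have : (Finset.univ : Finset V) ⊆ bag t ∪ A := by
          intro v _
          by_cases hv : v ∈ bag t
          · exact Finset.mem_union_left _ hv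
          · exact Finset.mem_union_right _ (hex v hv)
        have h1 := Finset.card_le_card this
        have h2 := Finset.card_union_le (bag t) A
        have h3 := hk t
        rw [Finset.card_univ] at h1
        omega

lemma treewidth_spec {V : Type} [Fintype V] [DecidableEq V] (G : SimpleGraph V) :
    ∃ (ι : Type) (T : SimpleGraph ι) (bag : ι → Finset V),
      IsTreeDecomp G T bag ∧ ∀ i, (bag i).card ≤ treewidth G + 1 := by
  have hne : {w | ∃ (ι : Type) (T : SimpleGraph ι) (bag : ι → Finset V),
      IsTreeDecomp G T bag ∧ ∀ i, (bag i).card ≤ w + 1}.Nonempty := by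
    refine ⟨Fintype.card V, Unit, ⊥, fun _ => Finset.univ, ⟨?_, ?_, ?_, ?_⟩, ?_⟩
    · exact SimpleGraph.IsTree.of_subsingleton
    · intro v; exact ⟨(), Finset.mem_univ _⟩
    · intro u v _; exact ⟨(), Finset.mem_univ _, Finset.mem_univ _⟩
    · intro v
      have : Nonempty {i : Unit | v ∈ (Finset.univ : Finset V)} := ⟨⟨(), Finset.mem_univ v⟩⟩
      exact SimpleGraph.Connected.mk (SimpleGraph.Preconnected.of_subsingleton)
    · intro i; simp
  exact Nat.sInf_mem hne

lemma two_pow_le_centralBinom (m : ℕ) : 2 ^ m ≤ m.centralBinom := by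
  induction m with
  | zero => simp
  | succ m ih =>
    have h := Nat.succ_mul_centralBinom_succ m
    rw [pow_succ]
    have : (m + 1) * (2 ^ m * 2) ≤ (m + 1) * (m + 1).centralBinom := by
      rw [h]; nlinarith
    exact Nat.le_of_mul_le_mul_left this (by omega)

lemma two_pow_le_choose (n w m : ℕ) (h1 : m ≤ w) (h2 : w + m ≤ n) : 2 ^ m ≤ n.choose w := by
  have aux : ∀ w, m ≤ w → 2 * w ≤ n → 2 ^ m ≤ n.choose w := by
    intro w hw hwn
    calc 2 ^ m ≤ 2 ^ w := Nat.pow_le_pow_right (by norm_num) hw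
      _ ≤ w.centralBinom := two_pow_le_centralBinom w
      _ = (2 * w).choose w := rfl
      _ ≤ n.choose w := Nat.choose_le_choose w hwn
  by_cases h : 2 * w ≤ n
  · exact aux w h1 h
  · rw [← Nat.choose_symm (by omega : w ≤ n)]
    exact aux _ (by omega) (by omega)

/-- Number of permutations mapping `W` onto `Y`. -/
lemma card_perm_map (n : ℕ) (W Y : Finset (Fin n)) :
    (Finset.univ.filter (fun σ : Equiv.Perm (Fin n) => W.map σ.toEmbedding = Y)).card
      * n.choose W.card ≤ n.factorial := by
  classical
  let N : Finset (Fin n) → ℕ := fun Y =>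
    (Finset.univ.filter (fun σ : Equiv.Perm (Fin n) => W.map σ.toEmbedding = Y)).card
  change N Y * n.choose W.card ≤ _
  by_cases hY : Y.card = W.card
  · have heq : ∀ Z ∈ Finset.powersetCard W.card (Finset.univ : Finset (Fin n)), N Y ≤ N Z := by
      intro Z hZ
      rw [Finset.mem_powersetCard] at hZ
      let e : {x // x ∈ Y} ≃ {x // x ∈ Z} := Finset.equivOfCardEq (hY.trans hZ.2.symm)
      let τ : Equiv.Perm (Fin n) := e.extendSubtype
      have hτ : Y.map τ.toEmbedding = Z := by
        apply Finset.eq_of_subset_of_card_le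
        · intro x hx
          rw [Finset.mem_map] at hx
          obtain ⟨y, hy, rfl⟩ := hx
          exact Equiv.extendSubtype_mem e y hy
        · rw [Finset.card_map, hY, hZ.2]
      apply Finset.card_le_card_of_injOn (fun σ => τ * σ)
      · intro σ hσ
        simp only [Finset.coe_filter, Finset.mem_univ, true_and, Set.mem_ofPred_eq] at hσ ⊢
        rw [← hτ, ← hσ, Finset.map_map]
        rfl
      · intro a _ b _ hab
        exact mul_left_cancel hab
    have hsum : ∑ Z ∈ Finset.powersetCard W.card (Finset.univ : Finset (Fin n)), N Z
        = n.factorial := by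
      have := Finset.card_eq_sum_card_fiberwise (s := (Finset.univ : Finset (Equiv.Perm (Fin n))))
        (f := fun σ => W.map σ.toEmbedding)
        (t := Finset.powersetCard W.card (Finset.univ : Finset (Fin n)))
        (by intro σ _; simp [Finset.mem_powersetCard])
      rw [Finset.card_univ, Fintype.card_perm, Fintype.card_fin] at this
      exact this.symm
    have := Finset.sum_le_sum heq
    rw [Finset.sum_const, Finset.card_powersetCard, Finset.card_univ, Fintype.card_fin, hsum,
      smul_eq_mul] at this
    rwa [mul_comm]
  · have : N Y = 0 := by
      simp only [N]
      rw [Finset.card_eq_zero, Finset.filter_eq_empty_iff]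
      intro σ _ h
      apply hY
      rw [← h, Finset.card_map]
    rw [this]; simp

/-- The family of subsets of `Fin n` of size at most `k`. -/
def smallSets (n k : ℕ) : Finset (Finset (Fin n)) := Finset.univ.filter (fun S => S.card ≤ k)

lemma card_smallSets (n k : ℕ) :
    ((smallSets n k).card : ℝ) ≤ (1025 / 1024) ^ n * 1024 ^ k := by
  have h := Fintype.sum_pow_mul_eq_add_pow (Fin n) (1 / 1024 : ℝ) 1
  simp only [one_pow, mul_one, Fintype.card_fin] at h
  have h1 : ∑ S ∈ smallSets n k, (1 / 1024 : ℝ) ^ k ≤ ∑ S : Finset (Fin n), (1 / 1024 : ℝ) ^ S.card := by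
    calc _ ≤ ∑ S ∈ smallSets n k, (1 / 1024 : ℝ) ^ S.card := by
          apply Finset.sum_le_sum
          intro S hS
          simp only [smallSets, Finset.mem_filter] at hS
          exact pow_le_pow_of_le_one (by norm_num) (by norm_num) hS.2
      _ ≤ _ := Finset.sum_le_sum_of_subset_of_nonneg (Finset.subset_univ _)
          (fun _ _ _ => by positivity)
  rw [h, Finset.sum_const, nsmul_eq_mul, one_div, inv_pow] at h1
  rw [← div_eq_mul_inv, div_le_iff₀ (by positivity)] at h1
  refine h1.trans (le_of_eq ?_)
  norm_num

/-- Boundary of a subset of `Fin n`. -/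
def bdry {n : ℕ} (U : Finset (Fin n)) : Finset (Fin n) :=
  Finset.univ.filter (fun i => ¬ (i ∈ U ↔ ∃ j ∈ U, (j : ℕ) + 1 = i))

lemma bdry_injective (n : ℕ) : Function.Injective (bdry (n := n)) := by
  intro U W h
  have key : ∀ m : ℕ, ∀ hm : m < n, ((⟨m, hm⟩ : Fin n) ∈ U ↔ (⟨m, hm⟩ : Fin n) ∈ W) := by
    intro m
    induction m with
    | zero =>
      intro hm
      have := congrArg (fun S => (⟨0, hm⟩ : Fin n) ∈ S) h
      simpa [bdry] using this
    | succ m ih =>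
      intro hm
      have hm' : m < n := by omega
      have h1 := congrArg (fun S => (⟨m + 1, hm⟩ : Fin n) ∈ S) h
      have hex : ∀ Z : Finset (Fin n),
          (∃ j ∈ Z, (j : ℕ) + 1 = m + 1) ↔ (⟨m, hm'⟩ : Fin n) ∈ Z := by
        intro Z
        constructor
        · rintro ⟨j, hj, hjm⟩
          have : j = ⟨m, hm'⟩ := Fin.ext (by simpa using hjm)
          rwa [← this]
        · intro hj; exact ⟨_, hj, rfl⟩
      simp only [bdry, Finset.mem_filter, Finset.mem_univ, true_and, hex, eq_iff_iff] at h1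
      have := ih hm'
      tauto
  ext i
  exact key i i.2

lemma card_bdry {n : ℕ} (U X : Finset (Fin n))
    (h : ∀ i j : Fin n, (j : ℕ) = i + 1 → ((i ∈ U ↔ j ∈ U) ∨ i ∈ X ∨ j ∈ X)) :
    (bdry U).card ≤ 2 * X.card + 1 := by
  classical
  have hsub : (bdry U).image (fun i : Fin n => (i : ℕ)) ⊆
      ({0} ∪ X.image (fun i : Fin n => (i : ℕ))) ∪ X.image (fun i : Fin n => (i : ℕ) + 1) := by
    intro m hm
    simp only [Finset.mem_image] at hm
    obtain ⟨i, hi, rfl⟩ := hm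
    simp only [bdry, Finset.mem_filter, Finset.mem_univ, true_and] at hi
    simp only [Finset.mem_union, Finset.mem_singleton, Finset.mem_image]
    by_cases h0 : (i : ℕ) = 0
    · exact Or.inl (Or.inl h0)
    · have hlt : (i : ℕ) - 1 < n := by omega
      have hji : (i : ℕ) = ((⟨(i : ℕ) - 1, hlt⟩ : Fin n) : ℕ) + 1 := by simp; omega
      rcases h ⟨(i : ℕ) - 1, hlt⟩ i hji with h1 | h1 | h1
      · exfalso
        apply hi
        rw [← h1]
        constructor
        · intro hj; exact ⟨_, hj, hji.symm⟩
        · rintro ⟨j, hj, hjm⟩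
          have : j = ⟨(i : ℕ) - 1, hlt⟩ := Fin.ext (by simp; omega)
          rwa [← this]
      · exact Or.inr ⟨_, h1, hji.symm⟩
      · exact Or.inl (Or.inr ⟨_, h1, rfl⟩)
  have h1 := Finset.card_le_card hsub
  rw [Finset.card_image_of_injective _ Fin.val_injective] at h1
  have h2 := Finset.card_union_le ({0} ∪ X.image (fun i : Fin n => (i : ℕ)))
    (X.image (fun i : Fin n => (i : ℕ) + 1))
  have h3 := Finset.card_union_le {0} (X.image (fun i : Fin n => (i : ℕ)))
  have h4 := Finset.card_image_le (s := X) (f := fun i : Fin n => (i : ℕ))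
  have h5 := Finset.card_image_le (s := X) (f := fun i : Fin n => (i : ℕ) + 1)
  simp only [Finset.card_singleton] at h3
  omega

/-- Sets of small boundary. -/
def lowSets (n k : ℕ) : Finset (Finset (Fin n)) := Finset.univ.filter (fun S => (bdry S).card ≤ k)

lemma card_lowSets (n k : ℕ) : (lowSets n k).card ≤ (smallSets n k).card := by
  apply Finset.card_le_card_of_injOn bdry
  · intro S hS
    simpa [lowSets, smallSets] using hS
  · exact (bdry_injective n).injOn

/-- The structure of `σ` when `G_σ` has small treewidth. -/
lemma bad_structure (n w : ℕ) (σ : Equiv.Perm (Fin n)) (hw : treewidth (Gsig n σ) ≤ w)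
    (hwn : 10000 * w ≤ n) (hn : 1000 ≤ n) :
    ∃ U ∈ lowSets n (2 * w + 3), ∃ W ∈ lowSets n (2 * w + 3), ∃ D ∈ smallSets n (w + 1),
      W.map σ.toEmbedding = symmDiff U D ∧ n / 10 ≤ W.card ∧ W.card + n / 10 ≤ n := by
  classical
  obtain ⟨ι, T, bag, hdec, hbag⟩ := treewidth_spec (Gsig n σ)
  have hcard : Fintype.card (Fin n ⊕ Fin n) = 2 * n := by simp; omega
  obtain ⟨A, X, hX, hAX, hadj, hA1, hA2⟩ := exists_separator (Gsig n σ) T bag hdec (w + 1)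
    (fun i => (hbag i).trans (by omega)) (by rw [hcard]; omega)
  rw [hcard] at hA1 hA2
  -- symmetric form of the separation property
  have hsep : ∀ u v, (Gsig n σ).Adj u v → (u ∈ A ↔ v ∈ A) ∨ u ∈ X ∨ v ∈ X := by
    intro u v huv
    have h1 := hadj u v
    have h2 := hadj v u
    have h3 := huv.symm
    tauto
  let U : Finset (Fin n) := Finset.univ.filter (fun i => Sum.inl i ∈ A)
  let W : Finset (Fin n) := Finset.univ.filter (fun p => Sum.inr (σ p) ∈ A)
  let X1 : Finset (Fin n) := Finset.univ.filter (fun i => Sum.inl i ∈ X)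
  let X2 : Finset (Fin n) := Finset.univ.filter (fun p => Sum.inr (σ p) ∈ X)
  let D : Finset (Fin n) := symmDiff U (W.map σ.toEmbedding)
  have hWm : ∀ i, i ∈ W.map σ.toEmbedding ↔ Sum.inr i ∈ A := by
    intro i
    simp only [W, Finset.mem_map, Finset.mem_filter, Finset.mem_univ, true_and,
      Equiv.coe_toEmbedding]
    constructor
    · rintro ⟨p, hp, rfl⟩; exact hp
    · intro h; exact ⟨σ.symm i, by simpa using h, by simp⟩
  have hX1 : X1.card ≤ X.card := by
    apply Finset.card_le_card_of_injOn (fun i => Sum.inl i)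
    · intro i hi; simpa [X1] using hi
    · intro a _ b _ h; exact Sum.inl_injective h
  have hX2 : X2.card ≤ X.card := by
    apply Finset.card_le_card_of_injOn (fun i => Sum.inr (σ i))
    · intro i hi; simpa [X2] using hi
    · intro a _ b _ h; exact σ.injective (Sum.inr_injective h)
  have hD : D.card ≤ X.card := by
    have hsub : D ⊆ X.image (Sum.elim id id) := by
      intro i hi
      have hm : (Gsig n σ).Adj (Sum.inl i) (Sum.inr i) := by simp [Gsig]
      rw [Finset.mem_image]
      simp only [D, Finset.mem_symmDiff, hWm, U, Finset.mem_filter, Finset.mem_univ, true_and] at hi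
      rcases hsep _ _ hm with h | h | h
      · tauto
      · exact ⟨_, h, rfl⟩
      · exact ⟨_, h, rfl⟩
    exact (Finset.card_le_card hsub).trans Finset.card_image_le
  have hUb : (bdry U).card ≤ 2 * X1.card + 1 := by
    apply card_bdry
    intro i j hij
    have hm : (Gsig n σ).Adj (Sum.inl i) (Sum.inl j) := by
      simp only [Gsig, SimpleGraph.fromRel_adj]
      refine ⟨?_, Or.inl hij⟩
      intro h
      have := Sum.inl_injective h
      subst this
      omega
    simpa [U, X1] using hsep _ _ hm
  have hWb : (bdry W).card ≤ 2 * X2.card + 1 := by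
    apply card_bdry
    intro i j hij
    have hm : (Gsig n σ).Adj (Sum.inr (σ i)) (Sum.inr (σ j)) := by
      simp only [Gsig, SimpleGraph.fromRel_adj]
      refine ⟨?_, Or.inl (by simpa using hij)⟩
      intro h
      have := σ.injective (Sum.inr_injective h)
      subst this
      omega
    simpa [W, X2] using hsep _ _ hm
  have hAc : A.card = U.card + W.card := by
    have : A = U.disjSum (W.map σ.toEmbedding) := by
      ext x
      rcases x with i | i
      · simp [U]
      · rw [Finset.inr_mem_disjSum, hWm]
    conv_lhs => rw [this, Finset.card_disjSum, Finset.card_map]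
  have hUW : U.card ≤ W.card + D.card := by
    rw [← Finset.card_map σ.toEmbedding (s := W)]
    refine le_trans (Finset.card_le_card ?_) (Finset.card_union_le _ _)
    intro i hi
    simp only [D, Finset.mem_union, Finset.mem_symmDiff]; tauto
  have hWU : W.card ≤ U.card + D.card := by
    rw [← Finset.card_map σ.toEmbedding (s := W)]
    refine le_trans (Finset.card_le_card ?_) (Finset.card_union_le _ _)
    intro i hi
    simp only [D, Finset.mem_union, Finset.mem_symmDiff]; tauto
  refine ⟨U, ?_, W, ?_, D, ?_, ?_, ?_, ?_⟩
  · simp only [lowSets, Finset.mem_filter, Finset.mem_univ, true_and]; omega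
  · simp only [lowSets, Finset.mem_filter, Finset.mem_univ, true_and]; omega
  · simp only [smallSets, Finset.mem_filter, Finset.mem_univ, true_and]; omega
  · exact (symmDiff_symmDiff_cancel_left U _).symm
  · omega
  · omega

lemma bad_count (n w : ℕ) (hwn : 10000 * w ≤ n) (hn : 1000 ≤ n) :
    Nat.card {σ : Equiv.Perm (Fin n) // treewidth (Gsig n σ) ≤ w} * 2 ^ (n / 10) ≤
      (smallSets n (2 * w + 3)).card * (smallSets n (2 * w + 3)).card
        * (smallSets n (w + 1)).card * n.factorial := by
  classical
  let Wb := (lowSets n (2 * w + 3)).filter (fun W => n / 10 ≤ W.card ∧ W.card + n / 10 ≤ n)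
  let P := (lowSets n (2 * w + 3) ×ˢ Wb) ×ˢ smallSets n (w + 1)
  let S : (Finset (Fin n) × Finset (Fin n)) × Finset (Fin n) → Finset (Equiv.Perm (Fin n)) :=
    fun p => Finset.univ.filter (fun σ => p.1.2.map σ.toEmbedding = symmDiff p.1.1 p.2)
  have h1 : Nat.card {σ : Equiv.Perm (Fin n) // treewidth (Gsig n σ) ≤ w} ≤ (P.biUnion S).card := by
    rw [Nat.card_eq_fintype_card, Fintype.card_subtype]
    apply Finset.card_le_card
    intro σ hσ
    simp only [Finset.mem_filter, Finset.mem_univ, true_and] at hσ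
    obtain ⟨U, hU, W, hW, D, hD, h, ha, hb⟩ := bad_structure n w σ hσ hwn hn
    rw [Finset.mem_biUnion]
    refine ⟨((U, W), D), ?_, ?_⟩
    · simp only [P, Wb, Finset.mem_product, Finset.mem_filter]
      exact ⟨⟨hU, hW, ha, hb⟩, hD⟩
    · simp only [S, Finset.mem_filter, Finset.mem_univ, true_and]
      exact h
  have h2 : ∀ p ∈ P, (S p).card * 2 ^ (n / 10) ≤ n.factorial := by
    intro p hp
    simp only [P, Wb, Finset.mem_product, Finset.mem_filter] at hp
    refine le_trans (Nat.mul_le_mul_left _ ?_) (card_perm_map n p.1.2 (symmDiff p.1.1 p.2))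
    exact two_pow_le_choose n _ _ hp.1.2.2.1 hp.1.2.2.2
  have hP : P.card ≤ (smallSets n (2 * w + 3)).card * (smallSets n (2 * w + 3)).card
        * (smallSets n (w + 1)).card := by
    simp only [P, Finset.card_product]
    have a := card_lowSets n (2 * w + 3)
    have b : Wb.card ≤ (lowSets n (2 * w + 3)).card := Finset.card_filter_le _ _
    exact Nat.mul_le_mul_right _ (Nat.mul_le_mul a (b.trans a))
  calc _ ≤ (P.biUnion S).card * 2 ^ (n / 10) := Nat.mul_le_mul_right _ h1
    _ ≤ (∑ p ∈ P, (S p).card) * 2 ^ (n / 10) := Nat.mul_le_mul_right _ Finset.card_biUnion_le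
    _ = ∑ p ∈ P, (S p).card * 2 ^ (n / 10) := Finset.sum_mul _ _ _
    _ ≤ ∑ p ∈ P, n.factorial := Finset.sum_le_sum h2
    _ = P.card * n.factorial := by rw [Finset.sum_const, smul_eq_mul]
    _ ≤ _ := Nat.mul_le_mul_right _ hP

lemma bad_prob (n : ℕ) (hn : 1000 ≤ n) :
    (Nat.card {σ : Equiv.Perm (Fin n) //
      (treewidth (Gsig n σ) : ℝ) < (1 / 10000 : ℝ) * (n : ℝ)} : ℝ) /
        (Nat.card (Equiv.Perm (Fin n)) : ℝ) ≤ 2 ^ 100 * (1 / 2) ^ (n / 100) := by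
  classical
  set w := n / 10000 with hwdef
  set m := n / 100 with hm
  have hsub : Nat.card {σ : Equiv.Perm (Fin n) //
      (treewidth (Gsig n σ) : ℝ) < (1 / 10000 : ℝ) * (n : ℝ)} ≤
      Nat.card {σ : Equiv.Perm (Fin n) // treewidth (Gsig n σ) ≤ w} := by
    rw [Nat.card_eq_fintype_card, Nat.card_eq_fintype_card]
    apply Fintype.card_subtype_mono
    intro σ hσ
    have h1 : ((10000 * treewidth (Gsig n σ) : ℕ) : ℝ) < (n : ℝ) := by push_cast; linarith
    have h2 := Nat.cast_lt.mp h1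
    change treewidth (Gsig n σ) ≤ w
    omega
  have hbad := bad_count n w (by omega) hn
  have hperm : Nat.card (Equiv.Perm (Fin n)) = n.factorial := by
    rw [Nat.card_eq_fintype_card, Fintype.card_perm, Fintype.card_fin]
  rw [hperm]
  have hfac : (0 : ℝ) < (n.factorial : ℝ) := by exact_mod_cast n.factorial_pos
  rw [div_le_iff₀ hfac]
  have hbadR : (Nat.card {σ : Equiv.Perm (Fin n) // treewidth (Gsig n σ) ≤ w} : ℝ)
      * 2 ^ (n / 10) ≤ ((smallSets n (2 * w + 3)).card : ℝ) * (smallSets n (2 * w + 3)).card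
        * (smallSets n (w + 1)).card * n.factorial := by exact_mod_cast hbad
  have hsubR : (Nat.card {σ : Equiv.Perm (Fin n) //
      (treewidth (Gsig n σ) : ℝ) < (1 / 10000 : ℝ) * (n : ℝ)} : ℝ) ≤
      Nat.card {σ : Equiv.Perm (Fin n) // treewidth (Gsig n σ) ≤ w} := by exact_mod_cast hsub
  have ha := card_smallSets n (2 * w + 3)
  have hb := card_smallSets n (w + 1)
  have hprod : ((smallSets n (2 * w + 3)).card : ℝ) * (smallSets n (2 * w + 3)).card
        * (smallSets n (w + 1)).card ≤ 2 ^ (m + 1) * 2 ^ (m + 71) := by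
    calc _ ≤ ((1025 / 1024 : ℝ) ^ n * 1024 ^ (2 * w + 3)) * ((1025 / 1024) ^ n * 1024 ^ (2 * w + 3))
          * ((1025 / 1024) ^ n * 1024 ^ (w + 1)) := by gcongr
      _ = (1025 / 1024 : ℝ) ^ (3 * n) * 2 ^ (10 * (5 * w + 7)) := by
          rw [show (1024 : ℝ) = 2 ^ 10 by norm_num]
          simp only [← pow_mul]
          ring
      _ ≤ ((1025 / 1024 : ℝ) ^ 300) ^ (m + 1) * 2 ^ (m + 71) := by
          rw [← pow_mul]
          exact mul_le_mul (pow_le_pow_right₀ (by norm_num) (by omega))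
            (pow_le_pow_right₀ (by norm_num) (by omega)) (by positivity) (by positivity)
      _ ≤ _ := by
          have h300 : (1025 / 1024 : ℝ) ^ 300 ≤ 2 := by
            have h100 : (1025 / 1024 : ℝ) ^ 100 ≤ 5 / 4 := by norm_num
            calc (1025 / 1024 : ℝ) ^ 300 = ((1025 / 1024) ^ 100) ^ 3 := by rw [← pow_mul]
              _ ≤ (5 / 4) ^ 3 := pow_le_pow_left₀ (by positivity) h100 3
              _ ≤ 2 := by norm_num
          exact mul_le_mul_of_nonneg_right (pow_le_pow_left₀ (by positivity) h300 _) (by positivity)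
  have h2 : (2 : ℝ) ^ (10 * m) ≤ 2 ^ (n / 10) := by
    apply pow_le_pow_right₀ (by norm_num); omega
  have hpos : (0 : ℝ) < 2 ^ (n / 10) := by positivity
  refine hsubR.trans ?_
  rw [← mul_le_mul_iff_left₀ hpos]
  refine hbadR.trans ?_
  calc _ ≤ (2 ^ (m + 1) * 2 ^ (m + 71) : ℝ) * n.factorial := by gcongr
    _ ≤ (2 ^ 100 * (1 / 2) ^ m * 2 ^ (10 * m)) * n.factorial := by
        refine mul_le_mul_of_nonneg_right ?_ hfac.le
        have : (2 ^ 100 * (1 / 2) ^ m * 2 ^ (10 * m) : ℝ) = 2 ^ (100 + 9 * m) := by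
          rw [show 10 * m = m + 9 * m by ring, pow_add 2 m, pow_add 2 100, one_div, inv_pow]
          field_simp
        rw [this, ← pow_add]
        apply pow_le_pow_right₀ (by norm_num); omega
    _ ≤ (2 ^ 100 * (1 / 2) ^ m * 2 ^ (n / 10)) * n.factorial := by gcongr
    _ = _ := by ring

/-- There is a constant `α > 0` such that, when `σ` is chosen uniformly
at random among the permutations of `{1,…,n}`, the probability that
`tw(G_σ) < α·n` tends to `0` as `n → ∞`. -/
theorem Gsig_linear_treewidth_whp :
    ∃ α : ℝ, 0 < α ∧
      Filter.Tendsto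
        (fun n : ℕ =>
          (Nat.card {σ : Equiv.Perm (Fin n) //
              (treewidth (Gsig n σ) : ℝ) < α * (n : ℝ)} : ℝ) /
            (Nat.card (Equiv.Perm (Fin n)) : ℝ))
        Filter.atTop (nhds 0) := by
  refine ⟨1 / 10000, by norm_num, ?_⟩
  have hlim : Filter.Tendsto (fun n : ℕ => (2 ^ 100 * (1 / 2) ^ (n / 100) : ℝ))
      Filter.atTop (nhds 0) := by
    have h1 : Filter.Tendsto (fun n : ℕ => n / 100) Filter.atTop Filter.atTop :=
      Filter.tendsto_atTop_atTop.mpr fun b => ⟨100 * b, fun a ha => by omega⟩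
    have h2 := (tendsto_pow_atTop_nhds_zero_of_lt_one (r := (1 / 2 : ℝ)) (by norm_num)
      (by norm_num)).comp h1
    simpa using h2.const_mul (2 ^ 100 : ℝ)
  refine tendsto_of_tendsto_of_tendsto_of_le_of_le' tendsto_const_nhds hlim ?_ ?_
  · exact Filter.Eventually.of_forall fun n => by positivity
  · filter_upwards [Filter.eventually_ge_atTop 1000] with n hn
    exact bad_prob n hn
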